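/- arXiv:2110.08533 — 3 statements merged into one kernel-verified Lean document; each statement's English description precedes it below -/
import Mathlib

section
/- Let w₁^L,w₂^L,w₃^L,w₁^R,w₂^R,w₃^R ∈ ℤ² with w₁^L+w₂^L+w₃^L = w₁^R+w₂^R+w₃^R = 0, and put A_j := w_j^L − w₁^R and B_j := −w_j^L + w₃^R for j = 1,2,3. Then the action of pairs t = (t₁,t₂) of unit complex numbers on SU(3) given by t·A = diag(t^{w₁^L}, t^{w₂^L}, t^{w₃^L}) · A · diag(t^{w₁^R}, t^{w₂^R}, t^{w₃^R})⁻¹ is free if and only if for every pair (i,j) with i ≠ j, the vectors A_i and B_j form a ℤ-basis of ℤ². -/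
open scoped BigOperators Matrix

/-- `SU(3)`: the 3×3 complex matrices `A` with `A*A = 1` and `det A = 1`. -/
def SU3 : Set (Matrix (Fin 3) (Fin 3) ℂ) :=
  {A | A.conjTranspose * A = 1 ∧ A.det = 1}

/-- `t^w = t₁^{w₁} t₂^{w₂}` for a pair of complex numbers `t` and `w ∈ ℤ²`. -/
noncomputable def tpow (t : ℂ × ℂ) (w : ℤ × ℤ) : ℂ := t.1 ^ w.1 * t.2 ^ w.2

/-- `u, v` form a `ℤ`-basis of `ℤ²` iff the determinant of the matrix with rows `u, v`
is `1` or `-1`. -/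
def IsZBasis (u v : ℤ × ℤ) : Prop :=
  u.1 * v.2 - u.2 * v.1 = 1 ∨ u.1 * v.2 - u.2 * v.1 = -1

theorem tpow_add {t : ℂ × ℂ} (h1 : t.1 ≠ 0) (h2 : t.2 ≠ 0) (u v : ℤ × ℤ) :
    tpow t (u + v) = tpow t u * tpow t v := by
  simp only [tpow, Prod.fst_add, Prod.snd_add, zpow_add₀ h1, zpow_add₀ h2]
  ring

theorem tpow_neg (t : ℂ × ℂ) (u : ℤ × ℤ) : tpow t (-u) = (tpow t u)⁻¹ := by
  simp [tpow, mul_comm]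

theorem tpow_ne_zero {t : ℂ × ℂ} (h1 : t.1 ≠ 0) (h2 : t.2 ≠ 0) (u : ℤ × ℤ) :
    tpow t u ≠ 0 :=
  mul_ne_zero (zpow_ne_zero _ h1) (zpow_ne_zero _ h2)

theorem tpow_sub_eq_one_iff {t : ℂ × ℂ} (h1 : t.1 ≠ 0) (h2 : t.2 ≠ 0) (u v : ℤ × ℤ) :
    tpow t (u - v) = 1 ↔ tpow t u = tpow t v := by
  rw [sub_eq_add_neg, tpow_add h1 h2, tpow_neg, mul_inv_eq_one₀ (tpow_ne_zero h1 h2 v)]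

theorem eq_one_of_zpow_eq_one {z : ℂ} {d : ℤ} (hd : d = 1 ∨ d = -1) (h : z ^ d = 1) :
    z = 1 := by
  rcases hd with rfl | rfl <;> simpa using h

/-- A pair of characters given by a `ℤ`-basis has trivial common kernel. -/
theorem IsZBasis.eq_one {u v : ℤ × ℤ} (h : IsZBasis u v) {t : ℂ × ℂ}
    (h1 : t.1 ≠ 0) (h2 : t.2 ≠ 0) (hu : tpow t u = 1) (hv : tpow t v = 1) : t = (1, 1) := by
  have key : ∀ a b : ℤ, t.1 ^ (u.1 * a + v.1 * b) * t.2 ^ (u.2 * a + v.2 * b) = 1 := by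
    intro a b
    calc _ = tpow t u ^ a * tpow t v ^ b := by
          simp only [tpow, zpow_add₀ h1, zpow_add₀ h2, mul_zpow, zpow_mul]
          ring
      _ = 1 := by simp [hu, hv]
  have k1 := key v.2 (-u.2)
  have k2 := key (-v.1) u.1
  rw [show u.2 * v.2 + v.2 * -u.2 = 0 by ring, zpow_zero, mul_one] at k1
  rw [show u.1 * -v.1 + v.1 * u.1 = 0 by ring, zpow_zero, one_mul] at k2
  refine Prod.ext (eq_one_of_zpow_eq_one ?_ k1) (eq_one_of_zpow_eq_one ?_ k2)
  · rcases h with h | h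
    · left; linarith
    · right; linarith
  · rcases h with h | h
    · left; linarith
    · right; linarith

/-- An integer matrix of determinant divisible by `p` has a vector in its kernel mod `p` that is
nonzero mod `p`. -/
theorem exists_kernel_mod {p : ℤ} (hp : ¬ p ∣ 1) {u v : ℤ × ℤ}
    (h : p ∣ u.1 * v.2 - u.2 * v.1) :
    ∃ x y : ℤ, ¬ (p ∣ x ∧ p ∣ y) ∧ p ∣ x * u.1 + y * u.2 ∧ p ∣ x * v.1 + y * v.2 := by
  by_cases hv : p ∣ v.2 ∧ p ∣ -v.1
  · by_cases hu : p ∣ -u.2 ∧ p ∣ u.1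
    · refine ⟨1, 0, fun h => hp h.1, ?_, ?_⟩
      · simpa using hu.2
      · simpa using hv.2
    · refine ⟨-u.2, u.1, hu, ⟨0, by ring⟩, ?_⟩
      convert h using 1
      ring
  · refine ⟨v.2, -v.1, hv, ?_, ⟨0, by ring⟩⟩
    convert h using 1
    ring

/-- If `u, v` is not a `ℤ`-basis, the common kernel of the two characters on the torus is
nontrivial. -/
theorem exists_ne_one_of_not_isZBasis {u v : ℤ × ℤ} (h : ¬ IsZBasis u v) :
    ∃ t : ℂ × ℂ, ‖t.1‖ = 1 ∧ ‖t.2‖ = 1 ∧ tpow t u = 1 ∧ tpow t v = 1 ∧ t ≠ (1, 1) := by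
  have hd : (u.1 * v.2 - u.2 * v.1).natAbs ≠ 1 := fun h' => h (Int.natAbs_eq_iff.1 h')
  obtain ⟨p, hp, hpd⟩ := Nat.exists_prime_and_dvd hd
  have hp1 : ¬ (p : ℤ) ∣ 1 := by
    intro h1
    exact hp.one_lt.ne' (Nat.dvd_one.1 (by exact_mod_cast h1))
  obtain ⟨x, y, hxy, hu, hv⟩ := exists_kernel_mod hp1 (Int.natCast_dvd.2 hpd)
  have hζ := Complex.isPrimitiveRoot_exp p hp.ne_zero
  set ζ := Complex.exp (2 * Real.pi * Complex.I / p)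
  have hn : ‖ζ‖ = 1 := hζ.norm'_eq_one hp.ne_zero
  have h0 : ζ ≠ 0 := hζ.ne_zero hp.ne_zero
  have hpow : ∀ w : ℤ × ℤ, tpow (ζ ^ x, ζ ^ y) w = ζ ^ (x * w.1 + y * w.2) := fun w => by
    simp only [tpow, zpow_add₀ h0, zpow_mul]
  refine ⟨(ζ ^ x, ζ ^ y), by simp [hn], by simp [hn], ?_, ?_, ?_⟩
  · rw [hpow, hζ.zpow_eq_one_iff_dvd]
    exact hu
  · rw [hpow, hζ.zpow_eq_one_iff_dvd]
    exact hv
  · intro h1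
    rw [Prod.mk.injEq, hζ.zpow_eq_one_iff_dvd, hζ.zpow_eq_one_iff_dvd] at h1
    exact hxy h1

theorem exists_perm_of_det_ne_zero {n R : Type*} [Fintype n] [DecidableEq n] [CommRing R]
    {A : Matrix n n R} (h : A.det ≠ 0) : ∃ σ : Equiv.Perm n, ∀ j, A (σ j) j ≠ 0 := by
  by_contra! hA
  refine h ?_
  rw [Matrix.det_apply]
  refine Finset.sum_eq_zero fun σ _ => ?_
  obtain ⟨j, hj⟩ := hA σ
  have hprod : ∏ i, A (σ i) i = 0 := Finset.prod_eq_zero (Finset.mem_univ j) hj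
  rw [hprod, smul_zero]

/-- Every permutation of the coordinates is realised up to sign in `SU(3)`. -/
theorem smul_submatrix_mem_SU3 (σ : Equiv.Perm (Fin 3)) :
    ((Equiv.Perm.sign σ : ℤ) : ℂ) • (1 : Matrix (Fin 3) (Fin 3) ℂ).submatrix σ id ∈ SU3 := by
  have hs : ((Equiv.Perm.sign σ : ℤ) : ℂ) * ((Equiv.Perm.sign σ : ℤ) : ℂ) = 1 := by
    rcases Int.units_eq_one_or (Equiv.Perm.sign σ) with h | h <;> simp [h]
  constructor
  · rw [Matrix.conjTranspose_smul, Matrix.conjTranspose_submatrix, Matrix.conjTranspose_one,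
      Matrix.smul_mul, Matrix.mul_smul, Matrix.submatrix_mul_equiv, smul_smul]
    simp [hs]
  · rw [Matrix.det_smul, Matrix.det_permute]
    simp only [Fintype.card_fin, Matrix.det_one, mul_one]
    linear_combination (((Equiv.Perm.sign σ : ℤ) : ℂ) * ((Equiv.Perm.sign σ : ℤ) : ℂ) + 1) * hs

theorem diagonal_mul_mul_inv_eq_iff {n : Type*} [Fintype n] [DecidableEq n] {a b : n → ℂ}
    (hb : ∀ j, b j ≠ 0) (A : Matrix n n ℂ) :
    Matrix.diagonal a * A * (Matrix.diagonal b)⁻¹ = A ↔ ∀ i j, A i j ≠ 0 → a i = b j := by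
  have hdet : IsUnit (Matrix.diagonal b).det := by
    rw [Matrix.det_diagonal]
    exact (Finset.prod_ne_zero_iff.2 fun j _ => hb j).isUnit
  have : Matrix.diagonal a * A * (Matrix.diagonal b)⁻¹ = A ↔
      Matrix.diagonal a * A = A * Matrix.diagonal b := by
    constructor
    · intro h
      conv_rhs => rw [← h]
      rw [Matrix.nonsing_inv_mul_cancel_right _ _ hdet]
    · intro h
      rw [h, Matrix.mul_nonsing_inv_cancel_right _ _ hdet]
  rw [this, ← Matrix.ext_iff]
  refine forall₂_congr fun i j => ?_
  rw [Matrix.diagonal_mul, Matrix.mul_diagonal, mul_comm, mul_eq_mul_left_iff]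
  tauto

theorem exists_perm_zero_two : ∀ i j : Fin 3, i ≠ j →
    ∃ σ : Equiv.Perm (Fin 3), σ 0 = i ∧ σ 2 = j := by
  decide

theorem stmt2 (wL wR : Fin 3 → ℤ × ℤ)
    (hL : wL 0 + wL 1 + wL 2 = 0) (hR : wR 0 + wR 1 + wR 2 = 0) :
    (∀ t : ℂ × ℂ, ‖t.1‖ = 1 → ‖t.2‖ = 1 →
      ∀ A ∈ SU3,
        Matrix.diagonal (fun j => tpow t (wL j)) * A *
            (Matrix.diagonal (fun j => tpow t (wR j)))⁻¹ = A →
        t = (1, 1)) ↔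
    (∀ i j : Fin 3, i ≠ j → IsZBasis (wL i - wR 0) (-wL j + wR 2)) := by
  constructor
  · intro hfree i j hij
    by_contra hbasis
    obtain ⟨t, ht1, ht2, hA, hB, hne⟩ := exists_ne_one_of_not_isZBasis hbasis
    have h1 : t.1 ≠ 0 := norm_ne_zero_iff.1 (by simp [ht1])
    have h2 : t.2 ≠ 0 := norm_ne_zero_iff.1 (by simp [ht2])
    obtain ⟨σ, rfl, rfl⟩ := exists_perm_zero_two i j hij
    rw [tpow_sub_eq_one_iff h1 h2] at hA
    rw [neg_add_eq_sub, tpow_sub_eq_one_iff h1 h2] at hB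
    have hLσ : wL (σ 0) + wL (σ 1) + wL (σ 2) = 0 := by
      have hsum := Equiv.sum_comp σ wL
      rwa [Fin.sum_univ_three, Fin.sum_univ_three, hL] at hsum
    have hC : tpow t (wL (σ 1)) = tpow t (wR 1) := by
      rw [show wL (σ 1) = -(wL (σ 0) + wL (σ 2)) by
          rw [eq_neg_iff_add_eq_zero, ← hLσ]; abel,
        show wR 1 = -(wR 0 + wR 2) by rw [eq_neg_iff_add_eq_zero, ← hR]; abel,
        tpow_neg, tpow_neg, tpow_add h1 h2, tpow_add h1 h2, hA, hB]
    have hall : ∀ k, tpow t (wL (σ k)) = tpow t (wR k) := by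
      intro k
      fin_cases k
      exacts [hA, hC, hB.symm]
    refine hne (hfree t ht1 ht2 _ (smul_submatrix_mem_SU3 σ⁻¹) ?_)
    rw [diagonal_mul_mul_inv_eq_iff fun k => tpow_ne_zero h1 h2 _]
    intro k l hkl
    have : σ⁻¹ k = l := by
      by_contra hne'
      refine hkl ?_
      rw [Matrix.smul_apply, Matrix.submatrix_apply, id, Matrix.one_apply_ne hne', smul_zero]
    rw [← hall, ← Equiv.Perm.inv_eq_iff_eq.1 this]
  · intro hbasis t ht1 ht2 A hA hfix
    have h1 : t.1 ≠ 0 := norm_ne_zero_iff.1 (by simp [ht1])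
    have h2 : t.2 ≠ 0 := norm_ne_zero_iff.1 (by simp [ht2])
    rw [diagonal_mul_mul_inv_eq_iff fun k => tpow_ne_zero h1 h2 _] at hfix
    obtain ⟨σ, hσ⟩ := exists_perm_of_det_ne_zero (A := A) (by simp [hA.2])
    refine (hbasis (σ 0) (σ 2) (by simp)).eq_one h1 h2 ?_ ?_
    · exact (tpow_sub_eq_one_iff h1 h2 _ _).2 (hfix _ _ (hσ 0))
    · rw [neg_add_eq_sub]
      exact (tpow_sub_eq_one_iff h1 h2 _ _).2 (hfix _ _ (hσ 2)).symm
end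

section
/- Let A₁,A₂,A₃,B₁,B₂,B₃ ∈ ℤ² and C ∈ ℤ² satisfy A_j + B_j = C for j = 1,2,3, assume condition (⋆) holds (viewing these vectors in ℝ²), and assume that for every pair (i,j) with i ≠ j the vectors A_i and B_j form a ℤ-basis of ℤ². Then A₁ = A₂ = A₃ and B₁ = B₂ = B₃. -/
open scoped BigOperators

/-- The cone spanned by two vectors in `ℝ²`. -/
def cone2 (u v : ℝ × ℝ) : Set (ℝ × ℝ) :=
  {x | ∃ a b : ℝ, 0 ≤ a ∧ 0 ≤ b ∧ x = a • u + b • v}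

/-- Condition (⋆). -/
def starCond (A B : Fin 3 → ℝ × ℝ) (C : ℝ × ℝ) : Prop :=
  (∀ i j : Fin 3, C ∉ cone2 (A i) (A j)) ∧
  (∀ i j : Fin 3, C ∉ cone2 (B i) (B j)) ∧
  (∀ i j : Fin 3, C ∈ cone2 (A i) (B j))

/-- The natural inclusion `ℤ² → ℝ²`. -/
def toR (w : ℤ × ℤ) : ℝ × ℝ := ((w.1 : ℝ), (w.2 : ℝ))

/-- The determinant of the matrix with rows `u, v`. -/
def det2 (u v : ℤ × ℤ) : ℤ := u.1 * v.2 - u.2 * v.1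

/-- If `u + v = w` and `u, w` are linearly dependent, then `w` lies on the ray spanned by `u`
or on the ray spanned by `v`. -/
lemma mem_cone2_self_of_det2_eq_zero {u v w : ℤ × ℤ} (hsum : u + v = w) (h : det2 u w = 0) :
    toR w ∈ cone2 (toR u) (toR u) ∨ toR w ∈ cone2 (toR v) (toR v) := by
  obtain ⟨x, y⟩ := u
  obtain ⟨p, q⟩ := w
  obtain rfl : v = (p - x, q - y) := by rw [← Prod.mk_sub_mk, ← hsum, add_sub_cancel_left]
  have hd : (x : ℝ) * q - y * p = 0 := by exact_mod_cast h
  simp only [cone2, toR, Set.mem_ofPred_eq, Prod.smul_mk, Prod.mk_add_mk, Prod.mk.injEq,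
    smul_eq_mul]
  push_cast
  generalize (x : ℝ) = x, (y : ℝ) = y, (p : ℝ) = p, (q : ℝ) = q at hd ⊢
  by_cases hn : p * p + q * q = 0
  · have hp : p = 0 := by nlinarith [mul_self_nonneg p, mul_self_nonneg q]
    have hq : q = 0 := by nlinarith [mul_self_nonneg p, mul_self_nonneg q]
    exact Or.inl ⟨0, 0, le_rfl, le_rfl, by simp [hp], by simp [hq]⟩
  have hpos : 0 < p * p + q * q :=
    lt_of_le_of_ne (add_nonneg (mul_self_nonneg p) (mul_self_nonneg q)) (Ne.symm hn)
  rcases lt_or_ge 0 (x * p + y * q) with hs | hs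
  · refine Or.inl ⟨(p * p + q * q) / (x * p + y * q), 0, by positivity, le_rfl, ?_, ?_⟩
    · rw [zero_mul, add_zero, div_mul_eq_mul_div, eq_div_iff hs.ne']
      linear_combination -q * hd
    · rw [zero_mul, add_zero, div_mul_eq_mul_div, eq_div_iff hs.ne']
      linear_combination p * hd
  · have ht : 0 < p * p + q * q - (x * p + y * q) := by linarith
    refine Or.inr ⟨(p * p + q * q) / (p * p + q * q - (x * p + y * q)), 0, by positivity,
      le_rfl, ?_, ?_⟩
    · rw [zero_mul, add_zero, div_mul_eq_mul_div, eq_div_iff ht.ne']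
      linear_combination q * hd
    · rw [zero_mul, add_zero, div_mul_eq_mul_div, eq_div_iff ht.ne']
      linear_combination -p * hd

/-- If `w` lies in the cone of `u, v`, then replacing one of `u, v` by `w` does not reverse
the orientation of the pair. -/
lemma det2_mul_nonneg_of_mem_cone2 {u v w : ℤ × ℤ} (h : toR w ∈ cone2 (toR u) (toR v)) :
    0 ≤ det2 u w * det2 u v ∧ 0 ≤ det2 w v * det2 u v := by
  obtain ⟨a, b, ha, hb, hw⟩ := h
  simp only [toR, Prod.smul_mk, Prod.mk_add_mk, Prod.mk.injEq, smul_eq_mul] at hw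
  obtain ⟨h1, h2⟩ := hw
  have hu : ((det2 u w * det2 u v : ℤ) : ℝ) = b * (det2 u v : ℝ) ^ 2 := by
    simp only [det2]
    push_cast
    rw [h1, h2]
    ring
  have hv : ((det2 w v * det2 u v : ℤ) : ℝ) = a * (det2 u v : ℝ) ^ 2 := by
    simp only [det2]
    push_cast
    rw [h1, h2]
    ring
  constructor
  · have : (0 : ℝ) ≤ ((det2 u w * det2 u v : ℤ) : ℝ) := hu ▸ by positivity
    exact_mod_cast this
  · have : (0 : ℝ) ≤ ((det2 w v * det2 u v : ℤ) : ℝ) := hv ▸ by positivity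
    exact_mod_cast this

/-- Two vectors with the same nonzero determinant against `w` and vanishing determinant against
each other are equal. -/
lemma eq_of_det2_eq {u v w : ℤ × ℤ} (huv : det2 u v = 0) (h : det2 u w = det2 v w)
    (h0 : det2 u w ≠ 0) : u = v := by
  simp only [det2] at huv h h0
  refine Prod.ext (mul_right_cancel₀ h0 ?_) (mul_right_cancel₀ h0 ?_)
  · linear_combination u.1 * h - w.1 * huv
  · linear_combination u.2 * h - w.2 * huv

theorem stmt3 (A B : Fin 3 → ℤ × ℤ) (C : ℤ × ℤ)
    (hsum : ∀ j, A j + B j = C)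
    (hstar : starCond (fun j => toR (A j)) (fun j => toR (B j)) (toR C))
    (hbasis : ∀ i j : Fin 3, i ≠ j → IsZBasis (A i) (B j)) :
    (A 0 = A 1 ∧ A 1 = A 2) ∧ (B 0 = B 1 ∧ B 1 = B 2) := by
  obtain ⟨hA, hB, hAB⟩ := hstar
  have hne (i : Fin 3) : det2 (A i) C ≠ 0 := fun h =>
    (mem_cone2_self_of_det2_eq_zero (hsum i) h).elim (hA i i) (hB i i)
  have hdet (i j : Fin 3) : det2 (A i) (B j) = det2 (A i) C - det2 (A i) (A j) := by
    rw [← hsum j]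
    simp only [det2, Prod.fst_add, Prod.snd_add]
    ring
  have hanti (i j : Fin 3) : det2 (A j) (A i) = -det2 (A i) (A j) := by
    simp only [det2]
    ring
  have hCB (j : Fin 3) : det2 C (B j) = det2 (A j) C := by
    rw [← hsum j]
    simp only [det2, Prod.fst_add, Prod.snd_add]
    ring
  have hsign (i j : Fin 3) (hij : i ≠ j) :
      (0 < det2 (A i) C ∧ 0 < det2 (A j) C ∧ det2 (A i) C - det2 (A i) (A j) = 1) ∨
      (det2 (A i) C < 0 ∧ det2 (A j) C < 0 ∧ det2 (A i) C - det2 (A i) (A j) = -1) := by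
    obtain ⟨h1, h2⟩ := det2_mul_nonneg_of_mem_cone2 (hAB i j)
    have hi := hne i
    have hj := hne j
    have he : det2 (A i) (B j) = 1 ∨ det2 (A i) (B j) = -1 := hbasis i j hij
    rw [hCB] at h2
    rw [← hdet]
    rcases he with he | he <;> rw [he] at h1 h2 ⊢ <;> omega
  have h01 := hsign 0 1 (by decide)
  have h10 := hsign 1 0 (by decide)
  have h12 := hsign 1 2 (by decide)
  have h21 := hsign 2 1 (by decide)
  have h02 := hsign 0 2 (by decide)
  have h20 := hsign 2 0 (by decide)
  rw [hanti 0 1] at h10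
  rw [hanti 1 2] at h21
  rw [hanti 0 2] at h20
  have hA01 : A 0 = A 1 := eq_of_det2_eq (by omega) (by omega) (hne 0)
  have hA12 : A 1 = A 2 := eq_of_det2_eq (by omega) (by omega) (hne 1)
  have hBA (j : Fin 3) : B j = C - A j := eq_sub_of_add_eq' (hsum j)
  exact ⟨⟨hA01, hA12⟩, by rw [hBA, hBA, hA01], by rw [hBA, hBA, hA12]⟩
end

section
/- Let A₁,A₂,A₃,B₁,B₂,B₃,C ∈ ℝ² with A₁+B₁ = A₂+B₂ = A₃+B₃, and assume condition (⋆). Then: (N) there exist i,j ∈ {1,2,3} with i ≠ j and a,b > 0 such that C = aA_i + bB_j; (R) A_i and B_j are linearly independent over ℝ whenever i ≠ j; and (C) C ∉ cone(A₁,A₂,A₃), C ∉ cone(B₁,B₂,B₃), the cone cone(A₁,A₂,A₃,B₁,B₂,B₃) has an apex (if x and −x both belong to it then x = 0), and A_j ≠ 0 and B_j ≠ 0 for all j. -/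
open scoped BigOperators

/-- The cone spanned by a finite family of vectors in `ℝ²`. -/
def coneFam {n : ℕ} (s : Fin n → ℝ × ℝ) : Set (ℝ × ℝ) :=
  {x | ∃ lam : Fin n → ℝ, (∀ i, 0 ≤ lam i) ∧ x = ∑ i, lam i • s i}

/-- The determinant of two vectors of the plane, bundled as a bilinear map. -/
noncomputable def planeDet : ℝ × ℝ →ₗ[ℝ] ℝ × ℝ →ₗ[ℝ] ℝ :=
  LinearMap.mk₂ ℝ (fun u v => u.1 * v.2 - u.2 * v.1)
    (fun _ _ _ => by simp only [Prod.fst_add, Prod.snd_add]; ring)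
    (fun _ _ _ => by simp only [Prod.smul_fst, Prod.smul_snd, smul_eq_mul]; ring)
    (fun _ _ _ => by simp only [Prod.fst_add, Prod.snd_add]; ring)
    (fun _ _ _ => by simp only [Prod.smul_fst, Prod.smul_snd, smul_eq_mul]; ring)

lemma planeDet_apply (u v : ℝ × ℝ) : planeDet u v = u.1 * v.2 - u.2 * v.1 := rfl

lemma planeDet_self (u : ℝ × ℝ) : planeDet u u = 0 := by
  rw [planeDet_apply]; ring

lemma exists_eq_smul_of_planeDet_eq_zero {u v : ℝ × ℝ} (hu : u ≠ 0) (h : planeDet u v = 0) :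
    ∃ t : ℝ, v = t • u := by
  rw [planeDet_apply] at h
  by_cases h1 : u.1 = 0
  · have h2 : u.2 ≠ 0 := fun h2 => hu (Prod.ext h1 h2)
    refine ⟨v.2 / u.2, Prod.ext ?_ ?_⟩ <;> simp only [Prod.smul_fst, Prod.smul_snd, smul_eq_mul]
    · field_simp
      linarith
    · field_simp
  · refine ⟨v.1 / u.1, Prod.ext ?_ ?_⟩ <;> simp only [Prod.smul_fst, Prod.smul_snd, smul_eq_mul]
    · field_simp
    · field_simp
      linarith

lemma smul_mem_cone2_left (u v : ℝ × ℝ) {a : ℝ} (ha : 0 ≤ a) : a • u ∈ cone2 u v :=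
  ⟨a, 0, ha, le_rfl, by simp⟩

/-- A vector in the cone of `u` and `v` but on neither ray is a positive combination of `u`
and `v`, and these are linearly independent. -/
lemma exists_pos_of_mem_cone2 {u v w : ℝ × ℝ} (hu : w ∉ cone2 u u) (hv : w ∉ cone2 v v)
    (h : w ∈ cone2 u v) :
    (∃ a b : ℝ, 0 < a ∧ 0 < b ∧ w = a • u + b • v) ∧ planeDet u v ≠ 0 := by
  obtain ⟨a, b, ha, hb, rfl⟩ := h
  have ha' : a ≠ 0 := by
    rintro rfl
    exact hv (by simpa using smul_mem_cone2_left v v hb)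
  have hb' : b ≠ 0 := by
    rintro rfl
    exact hu (by simpa using smul_mem_cone2_left u u ha)
  refine ⟨⟨a, b, ha.lt_of_ne' ha', hb.lt_of_ne' hb', rfl⟩, fun hdet => ?_⟩
  have hu0 : u ≠ 0 := by
    rintro rfl
    exact hv (by simpa using smul_mem_cone2_left v v hb)
  obtain ⟨t, rfl⟩ := exists_eq_smul_of_planeDet_eq_zero hu0 hdet
  have hw : a • u + b • t • u = (a + b * t) • u := by module
  rw [hw] at hu hv
  have hneg : a + b * t < 0 := by
    by_contra! hc
    exact hu (smul_mem_cone2_left u u hc)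
  have ht : t < 0 := by
    by_contra! hc
    have := mul_nonneg hb hc
    linarith
  have hmem := smul_mem_cone2_left (t • u) (t • u) (div_nonneg_of_nonpos hneg.le ht.le)
  rw [smul_smul, div_mul_cancel₀ _ ht.ne] at hmem
  exact hv hmem

lemma linearIndependent_pair_of_planeDet_ne_zero {u v : ℝ × ℝ} (h : planeDet u v ≠ 0) :
    LinearIndependent ℝ ![u, v] := by
  rw [LinearIndependent.pair_iff]
  intro s t hst
  have h1 := congrArg (planeDet u) hst
  have h2 := congrArg (fun x => planeDet x v) hst
  simp only [map_add, map_smul, map_zero, planeDet_self, smul_eq_mul, LinearMap.add_apply,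
    LinearMap.smul_apply, LinearMap.zero_apply, mul_zero, zero_add, add_zero] at h1 h2
  exact ⟨(mul_eq_zero.1 h2).resolve_right h, (mul_eq_zero.1 h1).resolve_right h⟩

/-- A nonnegative combination of vectors in an open half-plane vanishes only trivially. -/
lemma eq_zero_of_map_sum_smul_eq_zero {ι E : Type*} [Fintype ι] [AddCommGroup E] [Module ℝ E]
    (f : E →ₗ[ℝ] ℝ) {v : ι → E} (hv : ∀ i, 0 < f (v i)) {l : ι → ℝ} (hl : ∀ i, 0 ≤ l i)
    (h : f (∑ i, l i • v i) = 0) (i : ι) : l i = 0 := by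
  simp only [map_sum, map_smul, smul_eq_mul] at h
  rw [Finset.sum_eq_zero_iff_of_nonneg fun i _ => mul_nonneg (hl i) (hv i).le] at h
  exact (mul_eq_zero.1 (h i (Finset.mem_univ i))).resolve_right (hv i).ne'

/-- If the vectors `A i` and `B j` lie strictly on opposite sides of `C` with all the
determinants of `A i` and `B j` of the same sign, then they satisfy no nontrivial
nonnegative relation. -/
lemma eq_zero_of_sum_smul_add_sum_smul_eq_zero {ι κ : Type*} [Fintype ι] [Fintype κ]
    {A : ι → ℝ × ℝ} {B : κ → ℝ × ℝ} {C : ℝ × ℝ} {e : ℝ}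
    (hAC : ∀ i, 0 < e * planeDet (A i) C) (hCB : ∀ j, 0 < e * planeDet C (B j))
    (hAB : ∀ i j, 0 < e * planeDet (A i) (B j)) {l : ι → ℝ} {m : κ → ℝ}
    (hl : ∀ i, 0 ≤ l i) (hm : ∀ j, 0 ≤ m j)
    (h : ∑ i, l i • A i + ∑ j, m j • B j = 0) : (∀ i, l i = 0) ∧ ∀ j, m j = 0 := by
  have key : ∀ i, l i = 0 := by
    by_contra! hne
    obtain ⟨i, hi⟩ := hne
    have hX : ∀ j, 0 < (e • planeDet (∑ i, l i • A i)) (B j) := by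
      intro j
      simp only [map_sum, map_smul, LinearMap.smul_apply, LinearMap.sum_apply, smul_eq_mul,
        Finset.mul_sum]
      refine Finset.sum_pos' (fun k _ => ?_) ⟨i, Finset.mem_univ i, ?_⟩
      · rw [mul_left_comm]
        exact mul_nonneg (hl k) (hAB k j).le
      · rw [mul_left_comm]
        exact mul_pos ((hl i).lt_of_ne' hi) (hAB i j)
    have hm0 : ∀ j, m j = 0 := by
      refine eq_zero_of_map_sum_smul_eq_zero _ hX hm ?_
      rw [eq_neg_of_add_eq_zero_right h, map_neg, LinearMap.smul_apply, planeDet_self]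
      simp
    refine hi (eq_zero_of_map_sum_smul_eq_zero (e • planeDet.flip C) hAC hl ?_ i)
    simp only [hm0, zero_smul, Finset.sum_const_zero, add_zero] at h
    rw [h, map_zero]
  refine ⟨key, eq_zero_of_map_sum_smul_eq_zero (e • planeDet C) hCB hm ?_⟩
  simp only [key, zero_smul, Finset.sum_const_zero, zero_add] at h
  rw [h, map_zero]

/-- Condition (⋆) puts all `A i` strictly on one side of `C` and all `B j` strictly on the
other, the sign being recorded by `e`. -/
lemma starCond.exists_planeDet_pos {A B : Fin 3 → ℝ × ℝ} {C : ℝ × ℝ} (h : starCond A B C) :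
    ∃ e : ℝ, (∀ i, 0 < e * planeDet (A i) C) ∧ (∀ j, 0 < e * planeDet C (B j)) ∧
      ∀ i j, 0 < e * planeDet (A i) (B j) := by
  have key : ∀ i j, ∃ a b : ℝ, 0 < a ∧ 0 < b ∧ planeDet (A i) (B j) ≠ 0 ∧
      planeDet (A i) C = b * planeDet (A i) (B j) ∧
      planeDet C (B j) = a * planeDet (A i) (B j) := by
    intro i j
    obtain ⟨⟨a, b, ha, hb, hC⟩, hd⟩ :=
      exists_pos_of_mem_cone2 (h.1 i i) (h.2.1 j j) (h.2.2 i j)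
    refine ⟨a, b, ha, hb, hd, ?_, ?_⟩ <;> rw [hC] <;> simp [planeDet_self]
  have hCB : ∀ j, 0 < planeDet (A 0) C * planeDet C (B j) := by
    intro j
    obtain ⟨a, b, ha, hb, hd, h1, h2⟩ := key 0 j
    rw [h1, h2, mul_mul_mul_comm]
    exact mul_pos (mul_pos hb ha) (mul_self_pos.2 hd)
  have hAB : ∀ i j, 0 < planeDet (A 0) C * planeDet (A i) (B j) := by
    intro i j
    obtain ⟨a, b, ha, hb, hd, h1, h2⟩ := key i j
    have := hCB j
    rw [h2, mul_left_comm] at this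
    exact pos_of_mul_pos_right this ha.le
  refine ⟨planeDet (A 0) C, fun i => ?_, hCB, hAB⟩
  obtain ⟨a, b, ha, hb, hd, h1, h2⟩ := key i 0
  rw [h1, mul_left_comm]
  exact mul_pos hb (hAB i 0)

theorem stmt7 (A B : Fin 3 → ℝ × ℝ) (C : ℝ × ℝ)
    (hsum : A 0 + B 0 = A 1 + B 1 ∧ A 1 + B 1 = A 2 + B 2)
    (hstar : starCond A B C) :
    -- (N)
    (∃ i j : Fin 3, i ≠ j ∧ ∃ a b : ℝ, 0 < a ∧ 0 < b ∧ C = a • A i + b • B j) ∧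
    -- (R)
    (∀ i j : Fin 3, i ≠ j → LinearIndependent ℝ ![A i, B j]) ∧
    -- (C)
    (C ∉ coneFam A ∧ C ∉ coneFam B ∧
      (∀ x : ℝ × ℝ, x ∈ coneFam ![A 0, A 1, A 2, B 0, B 1, B 2] →
        -x ∈ coneFam ![A 0, A 1, A 2, B 0, B 1, B 2] → x = 0) ∧
      (∀ j, A j ≠ 0 ∧ B j ≠ 0)) := by
  obtain ⟨e, hAC, hCB, hAB⟩ := hstar.exists_planeDet_pos
  have hC0 : C ≠ 0 := fun h0 => by simpa [h0] using hAC 0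
  refine ⟨⟨0, 1, by decide, (exists_pos_of_mem_cone2 (hstar.1 0 0) (hstar.2.1 1 1)
    (hstar.2.2 0 1)).1⟩, fun i j _ => linearIndependent_pair_of_planeDet_ne_zero
      (right_ne_zero_of_mul (hAB i j).ne'), ?_, ?_, ?_, fun j => ⟨fun h0 => ?_, fun h0 => ?_⟩⟩
  · rintro ⟨l, hl, hC⟩
    have hl0 := eq_zero_of_map_sum_smul_eq_zero (e • planeDet.flip C) hAC hl
      (by rw [← hC]; simp [planeDet_self])
    exact hC0 (by simpa [hl0] using hC)
  · rintro ⟨m, hm, hC⟩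
    have hm0 := eq_zero_of_map_sum_smul_eq_zero (e • planeDet C) hCB hm
      (by rw [← hC]; simp [planeDet_self])
    exact hC0 (by simpa [hm0] using hC)
  · have hsplit : ∀ c : Fin 6 → ℝ, ∑ i, c i • ![A 0, A 1, A 2, B 0, B 1, B 2] i =
        ∑ i : Fin 3, c (Fin.castAdd 3 i) • A i + ∑ j : Fin 3, c (Fin.natAdd 3 j) • B j := by
      intro c
      rw [Fin.sum_univ_add (a := 3) (b := 3)]
      simp only [Fin.sum_univ_three]
      rfl
    rintro x ⟨c, hc, hx⟩ ⟨d, hd, hnx⟩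
    have hsum0 : ∑ i, (c + d) i • ![A 0, A 1, A 2, B 0, B 1, B 2] i = 0 := by
      simp only [Pi.add_apply, add_smul, Finset.sum_add_distrib]
      rw [← hx, ← hnx, add_neg_cancel]
    have hcd : ∀ i, 0 ≤ (c + d) i := fun i => add_nonneg (hc i) (hd i)
    rw [hsplit] at hsum0
    obtain ⟨h1, h2⟩ := eq_zero_of_sum_smul_add_sum_smul_eq_zero hAC hCB hAB
      (fun i => hcd _) (fun j => hcd _) hsum0
    have hc1 : ∀ i, c (Fin.castAdd 3 i) = 0 := fun i =>
      ((add_eq_zero_iff_of_nonneg (hc _) (hd _)).1 (h1 i)).1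
    have hc2 : ∀ j, c (Fin.natAdd 3 j) = 0 := fun j =>
      ((add_eq_zero_iff_of_nonneg (hc _) (hd _)).1 (h2 j)).1
    rw [hx, hsplit]
    simp only [hc1, hc2, zero_smul, Finset.sum_const_zero, add_zero]
  · simpa [h0] using hAC j
  · simpa [h0] using hCB j
end
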